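/- arXiv:1506.06422 — 2 statements merged into one kernel-verified Lean document; each statement's English description precedes it below -/
import Mathlib

section
/- Let X be a connected topological space, f : X → ℝ nonnegative and bounded, X_n ⊆ X a finite subset, 𝒞̂ a cluster tree on X_n equipped with the height function f restricted to X_n, and δ > 0. Suppose |m_𝒞̂(x, x') − m_f(x, x')| < δ for all x, x' ∈ X_n, where m_𝒞̂ is the merge height in (X_n, 𝒞̂, f) and m_f the merge height in the density cluster tree of f. Then for every λ and every connected component A of {f ≥ λ}, the set A ∩ X_n is connected at level λ − δ in (X_n, 𝒞̂, f). -/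
open Set

/-- Height of a cluster: infimum of the height function over the cluster. -/
noncomputable def clusterHeight {X : Type*} (h : X → ℝ) (C : Set X) : ℝ :=
  sInf (h '' C)

/-- Points `x` and `x'` are connected at level `lam` in the cluster tree `𝒞`
equipped with height function `h`. -/
def connectedAtLevel {X : Type*} (𝒞 : Set (Set X)) (h : X → ℝ) (lam : ℝ) (x x' : X) : Prop :=
  ∃ C ∈ 𝒞, x ∈ C ∧ x' ∈ C ∧ lam ≤ clusterHeight h C

/-- A set `S` is connected at level `lam`: every pair of its points is. -/
def setConnectedAtLevel {X : Type*} (𝒞 : Set (Set X)) (h : X → ℝ) (lam : ℝ) (S : Set X) : Prop :=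
  ∀ x ∈ S, ∀ x' ∈ S, connectedAtLevel 𝒞 h lam x x'

/-- Sets `S` and `S'` are separated at level `lam`. -/
def separatedAtLevel {X : Type*} (𝒞 : Set (Set X)) (h : X → ℝ) (lam : ℝ) (S S' : Set X) : Prop :=
  ∀ s ∈ S, ∀ s' ∈ S', ¬ connectedAtLevel 𝒞 h lam s s'

/-- Merge height of two points in a cluster tree equipped with a height function. -/
noncomputable def treeMergeHeight {X : Type*} (𝒞 : Set (Set X)) (h : X → ℝ) (x x' : X) : ℝ :=
  sSup {r | ∃ C ∈ 𝒞, x ∈ C ∧ x' ∈ C ∧ r = clusterHeight h C}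

/-- `𝒞` is a cluster tree on the set `Y`: `Y ∈ 𝒞`, all clusters are subsets of `Y`,
and any two clusters are nested or disjoint (laminar family). -/
def IsClusterTreeOn {X : Type*} (Y : Set X) (𝒞 : Set (Set X)) : Prop :=
  Y ∈ 𝒞 ∧ (∀ C ∈ 𝒞, C ⊆ Y) ∧ ∀ C ∈ 𝒞, ∀ C' ∈ 𝒞, C ∩ C' = ∅ ∨ C ⊆ C' ∨ C' ⊆ C

/-- `A` is a connected component of the superlevel set `{y | lam ≤ f y}`. -/
def IsCCOfSuplevel {X : Type*} [TopologicalSpace X] (f : X → ℝ) (lam : ℝ) (A : Set X) : Prop :=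
  ∃ x, lam ≤ f x ∧ A = connectedComponentIn {y | lam ≤ f y} x

/-- Merge height of two points in the density cluster tree of `f`. -/
noncomputable def densityMergeHeight {X : Type*} [TopologicalSpace X] (f : X → ℝ)
    (x x' : X) : ℝ :=
  sSup {lam | x' ∈ connectedComponentIn {y | lam ≤ f y} x}

/-- The merge level `μ = inf_{a ∈ A, b ∈ B} m_f(a,b)` of two sets in the density
cluster tree of `f`. -/
noncomputable def densityMergeOf {X : Type*} [TopologicalSpace X] (f : X → ℝ)
    (A B : Set X) : ℝ :=
  sInf (Set.image2 (densityMergeHeight f) A B)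

/-- Two points of one component of `{f ≥ lam}` merge in the density cluster tree at height at
least `lam`. -/
theorem le_densityMergeHeight {X : Type*} [TopologicalSpace X] {f : X → ℝ} {lam : ℝ} {x x' : X}
    (h : x' ∈ connectedComponentIn {y | lam ≤ f y} x) : lam ≤ densityMergeHeight f x x' :=
  le_csSup ⟨f x, fun r hr => by
    have hx : x ∈ {y | r ≤ f y} := connectedComponentIn_nonempty_iff.mp ⟨x', hr⟩
    exact hx⟩ h

/-- Below the merge height, two points are connected. -/
theorem connectedAtLevel_of_lt_treeMergeHeight {X : Type*} {Y : Set X} {𝒞 : Set (Set X)}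
    (h𝒞 : IsClusterTreeOn Y 𝒞) {h : X → ℝ} {lam : ℝ} {x x' : X} (hx : x ∈ Y) (hx' : x' ∈ Y)
    (hlt : lam < treeMergeHeight 𝒞 h x x') : connectedAtLevel 𝒞 h lam x x' := by
  have hne : {r | ∃ C ∈ 𝒞, x ∈ C ∧ x' ∈ C ∧ r = clusterHeight h C}.Nonempty :=
    ⟨clusterHeight h Y, Y, h𝒞.1, hx, hx', rfl⟩
  obtain ⟨_, ⟨C, hC, hxC, hxC', rfl⟩, hr⟩ := exists_lt_of_lt_csSup hne hlt
  exact ⟨C, hC, hxC, hxC', hr.le⟩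

/-- Small merge distortion implies minimality: if all merge heights in the empirical
tree are within `δ` of the true ones, then every connected component `A` of
`{f ≥ lam}` has `A ∩ X_n` connected at level `lam - δ`. -/
theorem merge_distortion_implies_minimality {X : Type*} [TopologicalSpace X]
    [ConnectedSpace X] (f : X → ℝ) (hf0 : ∀ x, 0 ≤ f x) (hfbdd : ∃ M, ∀ x, f x ≤ M)
    (Xn : Set X) (hXnfin : Xn.Finite)
    (𝒞 : Set (Set X)) (h𝒞 : IsClusterTreeOn Xn 𝒞)
    (δ : ℝ) (hδ : 0 < δ)
    (hdist : ∀ x ∈ Xn, ∀ x' ∈ Xn,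
      |treeMergeHeight 𝒞 f x x' - densityMergeHeight f x x'| < δ) :
    ∀ lam : ℝ, ∀ A : Set X, IsCCOfSuplevel f lam A →
      setConnectedAtLevel 𝒞 f (lam - δ) (A ∩ Xn) := by
  rintro lam _ ⟨z, -, rfl⟩ x ⟨hxA, hx⟩ x' ⟨hxA', hx'⟩
  rw [connectedComponentIn_eq hxA] at hxA'
  have hle := le_densityMergeHeight hxA'
  have hlow := (abs_lt.mp (hdist x hx x' hx')).1
  exact connectedAtLevel_of_lt_treeMergeHeight h𝒞 hx hx' (by linarith)
end

section
/- Let X be a connected topological space, f : X → ℝ nonnegative and bounded, X_n ⊆ X a finite subset, 𝒞̂ a cluster tree on X_n equipped with the height function f restricted to X_n, and δ > 0. Suppose |m_𝒞̂(x, x') − m_f(x, x')| < δ for all x, x' ∈ X_n, where m_𝒞̂ is the merge height in (X_n, 𝒞̂, f) and m_f the merge height in the density cluster tree of f. Then for every λ and any two disjoint connected components A, A' of {f ≥ λ}, the sets A ∩ X_n and A' ∩ X_n are separated at level μ + δ in (X_n, 𝒞̂, f), where μ := inf_{a ∈ A, a' ∈ A'} m_f(a, a'). -/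
open Set

/-- The levels at which two points of a density cluster tree are connected are bounded above. -/
lemma bddAbove_densityConnectedLevels {X : Type*} [TopologicalSpace X] (f : X → ℝ) (x x' : X) :
    BddAbove {lam | x' ∈ connectedComponentIn {y | lam ≤ f y} x} :=
  ⟨f x', fun r hr => connectedComponentIn_subset {y | r ≤ f y} x hr⟩

/-- Any two points of a connected space are connected at level `0` of a nonnegative function. -/
lemma zero_mem_densityConnectedLevels {X : Type*} [TopologicalSpace X] [ConnectedSpace X]
    {f : X → ℝ} (hf0 : ∀ x, 0 ≤ f x) (x x' : X) :
    (0 : ℝ) ∈ {lam | x' ∈ connectedComponentIn {y | lam ≤ f y} x} := by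
  have h : {y | (0 : ℝ) ≤ f y} = univ := eq_univ_of_forall hf0
  simp [h, connectedComponentIn_univ]

/-- Two points from disjoint components at level `lam` that are connected at a level `r`
witness that the two components are connected at level `r`. -/
lemma mem_connectedComponentIn_of_disjoint_components {X : Type*} [TopologicalSpace X]
    {f : X → ℝ} {lam r : ℝ} {A A' : Set X} (hA : IsCCOfSuplevel f lam A)
    (hA' : IsCCOfSuplevel f lam A') (hAA' : A ∩ A' = ∅) {s s' a a' : X}
    (hs : s ∈ A) (hs' : s' ∈ A') (ha : a ∈ A) (ha' : a' ∈ A')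
    (h : s' ∈ connectedComponentIn {y | r ≤ f y} s) :
    a' ∈ connectedComponentIn {y | r ≤ f y} a := by
  obtain ⟨x, -, rfl⟩ := hA
  obtain ⟨x', -, rfl⟩ := hA'
  rcases le_total lam r with hr | hr
  · have hmem : s' ∈ connectedComponentIn {y | lam ≤ f y} x := by
      rw [connectedComponentIn_eq hs]
      exact connectedComponentIn_mono s (fun y hy => hr.trans hy) h
    exact absurd hAA' (Set.Nonempty.ne_empty ⟨s', hmem, hs'⟩)
  · have hsub : {y | lam ≤ f y} ⊆ {y | r ≤ f y} := fun y hy => hr.trans hy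
    rw [connectedComponentIn_eq hs] at ha
    rw [connectedComponentIn_eq hs'] at ha'
    rw [← connectedComponentIn_eq (connectedComponentIn_mono s hsub ha), connectedComponentIn_eq h]
    exact connectedComponentIn_mono s' hsub ha'

/-- The merge height of disjoint components is at least that of each pair of their points. -/
lemma densityMergeHeight_le_densityMergeOf {X : Type*} [TopologicalSpace X] [ConnectedSpace X]
    {f : X → ℝ} (hf0 : ∀ x, 0 ≤ f x) {lam : ℝ} {A A' : Set X} (hA : IsCCOfSuplevel f lam A)
    (hA' : IsCCOfSuplevel f lam A') (hAA' : A ∩ A' = ∅) {s s' : X} (hs : s ∈ A) (hs' : s' ∈ A') :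
    densityMergeHeight f s s' ≤ densityMergeOf f A A' := by
  refine le_csInf ⟨_, mem_image2_of_mem hs hs'⟩ ?_
  rintro _ ⟨a, ha, a', ha', rfl⟩
  exact csSup_le_csSup (bddAbove_densityConnectedLevels f a a')
    ⟨0, zero_mem_densityConnectedLevels hf0 s s'⟩ fun _ hr =>
      mem_connectedComponentIn_of_disjoint_components hA hA' hAA' hs hs' ha ha' hr

/-- The height of a cluster bounds from below the merge height of its points. -/
lemma clusterHeight_le_treeMergeHeight {X : Type*} {𝒞 : Set (Set X)} {f : X → ℝ}
    (hf : BddBelow (range f)) {C : Set X} (hC : C ∈ 𝒞) {x x' : X} (hx : x ∈ C) (hx' : x' ∈ C) :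
    clusterHeight f C ≤ treeMergeHeight 𝒞 f x x' := by
  refine le_csSup ⟨f x, ?_⟩ ⟨C, hC, hx, hx', rfl⟩
  rintro _ ⟨D, -, hD, -, rfl⟩
  exact csInf_le (hf.mono (image_subset_range f D)) (mem_image_of_mem f hD)

/-- Small merge distortion implies separation: if all merge heights in the empirical
tree are within `δ` of the true ones, then any two disjoint connected components
`A, A'` of `{f ≥ lam}` have `A ∩ X_n` and `A' ∩ X_n` separated at level `μ + δ`,
where `μ` is their merge height in the density cluster tree. -/
theorem merge_distortion_implies_separation {X : Type*} [TopologicalSpace X]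
    [ConnectedSpace X] (f : X → ℝ) (hf0 : ∀ x, 0 ≤ f x) (hfbdd : ∃ M, ∀ x, f x ≤ M)
    (Xn : Set X) (hXnfin : Xn.Finite)
    (𝒞 : Set (Set X)) (h𝒞 : IsClusterTreeOn Xn 𝒞)
    (δ : ℝ) (hδ : 0 < δ)
    (hdist : ∀ x ∈ Xn, ∀ x' ∈ Xn,
      |treeMergeHeight 𝒞 f x x' - densityMergeHeight f x x'| < δ) :
    ∀ lam : ℝ, ∀ A A' : Set X,
      IsCCOfSuplevel f lam A → IsCCOfSuplevel f lam A' → A ∩ A' = ∅ →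
      separatedAtLevel 𝒞 f (densityMergeOf f A A' + δ) (A ∩ Xn) (A' ∩ Xn) := by
  rintro lam A A' hA hA' hAA' s ⟨hs, hsn⟩ s' ⟨hs', hsn'⟩ ⟨C, hC, hsC, hsC', hlev⟩
  have hfb : BddBelow (range f) := ⟨0, forall_mem_range.2 hf0⟩
  have h1 := clusterHeight_le_treeMergeHeight hfb hC hsC hsC'
  have h2 := densityMergeHeight_le_densityMergeOf hf0 hA hA' hAA' hs hs'
  have h3 := (abs_lt.1 (hdist s hsn s' hsn')).2
  linarith
end
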